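/- Suppose n, d → ∞ with d²/(n log n) → ρ for some ρ ∈ (0,∞). Then: if ρ > 8, lim_{n→∞} n·P(F_1) = 0; and if ρ < 8, lim_{n→∞} n·P(F_1) = ∞. -/

import Mathlib

open MeasureTheory ProbabilityTheory Filter Topology Matrix

noncomputable section

/-- The law `N(0, I_d/d)` on `ℝ^d`. -/
def stdGaussianVec (d : ℕ) : Measure (Fin d → ℝ) :=
  Measure.pi fun _ => gaussianReal 0 (d : NNReal)⁻¹

/-- The Gaussian model: `u_1, …, u_n, v_1, …, v_n` mutually independent `N(0, I_d/d)`. -/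
def gaussianModel (d n : ℕ) :
    Measure ((Fin n → Fin d → ℝ) × (Fin n → Fin d → ℝ)) :=
  (Measure.pi fun _ : Fin n => stdGaussianVec d).prod
    (Measure.pi fun _ : Fin n => stdGaussianVec d)

/-- The correlation matrix memory `W^× = U Vᵀ`. -/
def Wcross {d n : ℕ} (u v : Fin n → Fin d → ℝ) : Matrix (Fin d) (Fin d) ℝ :=
  Matrix.of fun a b => ∑ i, u i a * v i b

/-- The score `s_{j,i} = u_j^⊤ W^× v_i` under the correlation matrix memory. -/
def scoreX {d n : ℕ} (u v : Fin n → Fin d → ℝ) (j i : Fin n) : ℝ :=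
  u j ⬝ᵥ (Wcross u v).mulVec (v i)

/-- The retrieval failure event `F_{i₀} = {s_{i₀,i₀} ≤ max_{j ≠ i₀} s_{j,i₀}}`,
with the (0-based) index `i₀` given as a natural number. -/
def failSet (d n : ℕ) (i₀ : ℕ) : Set ((Fin n → Fin d → ℝ) × (Fin n → Fin d → ℝ)) :=
  {p | ∃ i j : Fin n, (i : ℕ) = i₀ ∧ j ≠ i ∧ scoreX p.1 p.2 i i ≤ scoreX p.1 p.2 j i}

/-- The law of a vector with independent `N(0, v)` coordinates. -/
abbrev gaussPi (ι : Type*) [Fintype ι] (v : NNReal) : Measure (ι → ℝ) :=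
  Measure.pi fun _ => gaussianReal 0 v

lemma charFunDual_gaussianReal_zero (v : NNReal) (L : StrongDual ℝ ℝ) :
    charFunDual (gaussianReal 0 v) L = Complex.exp (-(v * (L 1 : ℝ) ^ 2 / 2 : ℝ)) := by
  have h : L = (L 1) • ContinuousLinearMap.id ℝ ℝ := by
    ext; simp
  rw [h, ← charFun_map_eq_charFunDual_smul]
  simp [charFun_gaussianReal]

lemma charFunDual_gaussPi {ι : Type*} [Fintype ι] [DecidableEq ι] (v : NNReal)
    (L : StrongDual ℝ (ι → ℝ)) :
    charFunDual (gaussPi ι v) L =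
      Complex.exp (-(v * (∑ i, L (Pi.single i 1) ^ 2) / 2 : ℝ)) := by
  rw [charFunDual_pi]
  simp_rw [charFunDual_gaussianReal_zero]
  rw [← Complex.exp_sum]
  congr 1
  push_cast
  simp [Finset.mul_sum, Finset.sum_div]

lemma charFunDual_pi_gaussPi {ι κ : Type*} [Fintype ι] [Fintype κ] [DecidableEq ι] [DecidableEq κ]
    (v : NNReal) (L : StrongDual ℝ (κ → ι → ℝ)) :
    charFunDual (Measure.pi fun _ : κ => gaussPi ι v) L =
      Complex.exp (-(v * (∑ k, ∑ i, L (Pi.single k (Pi.single i 1)) ^ 2) / 2 : ℝ)) := by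
  rw [charFunDual_pi]
  simp_rw [charFunDual_gaussPi]
  rw [← Complex.exp_sum]
  congr 1
  push_cast
  simp [Finset.mul_sum, Finset.sum_div]

/-- A linear combination of independent centered Gaussians is a centered Gaussian. -/
lemma gaussPi_map_dot {ι : Type*} [Fintype ι] (v : NNReal) (x : ι → ℝ) :
    (gaussPi ι v).map (fun u => ∑ i, u i * x i) =
      gaussianReal 0 (v * (∑ i, x i ^ 2).toNNReal) := by
  classical
  let M : StrongDual ℝ (ι → ℝ) := ∑ i, x i • ContinuousLinearMap.proj (R := ℝ) (φ := fun _ => ℝ) i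
  have hM : (fun u : ι → ℝ => ∑ i, u i * x i) = M := by
    ext u; simp [M, mul_comm]
  rw [hM]
  apply Measure.ext_of_charFunDual
  ext L
  rw [charFunDual_map, charFunDual_gaussPi, charFunDual_gaussianReal_zero]
  have h1 : ∀ i, L (M (Pi.single i 1)) = L 1 * x i := by
    intro i
    have : M (Pi.single i 1) = x i • (1 : ℝ) := by
      simp [M, Pi.single_apply]
    rw [this, map_smul, smul_eq_mul, mul_comm]
  congr 3
  simp only [ContinuousLinearMap.comp_apply, h1, mul_pow, ← Finset.mul_sum]
  push_cast
  rw [Real.coe_toNNReal _ (Finset.sum_nonneg fun i _ => sq_nonneg _)]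
  ring

lemma strongDual_eq_sum {ι κ : Type*} [Fintype ι] [Fintype κ] [DecidableEq ι] [DecidableEq κ]
    (L : StrongDual ℝ (κ → ι → ℝ)) (U : κ → ι → ℝ) :
    L U = ∑ k, ∑ i, U k i * L (Pi.single k (Pi.single i 1)) := by
  have h : U = ∑ k, ∑ i, U k i • Pi.single k (Pi.single i 1) := by
    ext k i
    simp [Finset.sum_apply, Pi.single_apply, apply_ite, ite_apply]
  conv_lhs => rw [h]
  simp [map_sum]

/-- Replacing the component of a Gaussian matrix along a unit vector `e` by an independent
Gaussian vector `y`. -/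
def resample {ι κ : Type*} [Fintype κ] (e : κ → ℝ) (p : (ι → ℝ) × (κ → ι → ℝ)) : κ → ι → ℝ :=
  fun k i => p.2 k i + (p.1 i - ∑ l, e l * p.2 l i) * e k

lemma map_resample {ι κ : Type*} [Fintype ι] [Fintype κ] (v : NNReal) (e : κ → ℝ)
    (he : ∑ k, e k ^ 2 = 1) :
    ((gaussPi ι v).prod (Measure.pi fun _ : κ => gaussPi ι v)).map (resample e) =
      Measure.pi fun _ : κ => gaussPi ι v := by
  classical
  let Φ₀ : ((ι → ℝ) × (κ → ι → ℝ)) →ₗ[ℝ] (κ → ι → ℝ) :=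
    { toFun := resample e
      map_add' := by
        intro p q
        ext k i
        simp [resample, mul_add, Finset.sum_add_distrib]
        ring
      map_smul' := by
        intro c p
        ext k i
        have : ∑ l, e l * (c * p.2 l i) = c * ∑ l, e l * p.2 l i := by
          rw [Finset.mul_sum]; congr 1; ext; ring
        simp [resample, this]
        ring }
  let Φ := LinearMap.toContinuousLinearMap Φ₀
  have hΦ : resample e = Φ := rfl
  rw [hΦ]
  apply Measure.ext_of_charFunDual
  ext L
  rw [charFunDual_map, charFunDual_prod, charFunDual_gaussPi, charFunDual_pi_gaussPi,
    charFunDual_pi_gaussPi, ← Complex.exp_add]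
  set c : κ → ι → ℝ := fun k i => L (Pi.single k (Pi.single i 1)) with hc
  set m : ι → ℝ := fun i => ∑ k, e k * c k i with hm
  have h1 : ∀ i, (((L.comp Φ).comp (.inl ℝ (ι → ℝ) (κ → ι → ℝ))) (Pi.single i 1)) = m i := by
    intro i
    change L (resample e (Pi.single i 1, 0)) = _
    rw [strongDual_eq_sum]
    simp [resample, hm, hc, Pi.single_apply]
  have h2 : ∀ k i, (((L.comp Φ).comp (.inr ℝ (ι → ℝ) (κ → ι → ℝ)))
      (Pi.single k (Pi.single i 1))) = c k i - m i * e k := by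
    intro k i
    change L (resample e (0, Pi.single k (Pi.single i 1))) = _
    have : resample e ((0 : ι → ℝ), Pi.single k (Pi.single i 1)) =
        Pi.single k (Pi.single i 1) - e k • fun l j => (Pi.single i 1 : ι → ℝ) j * e l := by
      ext l j
      have : ∑ x, e x * (Pi.single k (Pi.single i 1) : κ → ι → ℝ) x j
          = e k * (Pi.single i 1 : ι → ℝ) j := by
        rw [Finset.sum_eq_single k] <;> simp +contextual [Pi.single_apply]
      simp only [resample, this]
      simp
      ring
    have h : L (fun l j => (Pi.single i 1 : ι → ℝ) j * e l) = m i := by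
      rw [strongDual_eq_sum]
      simp [hm, hc, Pi.single_apply]
    rw [this, map_sub, map_smul, h, smul_eq_mul, mul_comm]
  simp only [h1, h2]
  rw [← Complex.ofReal_neg, ← Complex.ofReal_neg, ← Complex.ofReal_neg, ← Complex.ofReal_add]
  congr 2
  have h3 : ∑ k, ∑ i, (c k i - m i * e k) ^ 2 = ∑ k, ∑ i, c k i ^ 2 - ∑ i, m i ^ 2 := by
    rw [Finset.sum_comm, Finset.sum_comm (f := fun k i => c k i ^ 2), ← Finset.sum_sub_distrib]
    refine Finset.sum_congr rfl fun i _ => ?_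
    have : ∑ k, (c k i - m i * e k) ^ 2 =
        ∑ k, c k i ^ 2 - 2 * m i * ∑ k, e k * c k i + m i ^ 2 * ∑ k, e k ^ 2 := by
      rw [Finset.mul_sum Finset.univ (fun k => e k * c k i) (2 * m i),
        Finset.mul_sum Finset.univ (fun k => e k ^ 2), ← Finset.sum_sub_distrib,
        ← Finset.sum_add_distrib]
      refine Finset.sum_congr rfl fun k _ => ?_
      ring
    rw [this, he]
    change _ - 2 * m i * m i + _ = _
    ring
  rw [h3]
  ring

lemma gaussianReal_tail_le (v : NNReal) {t : ℝ} (ht : 0 ≤ t) :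
    (gaussianReal 0 v).real {x | t ≤ x} ≤ Real.exp (-t ^ 2 / (2 * v)) := by
  have h : HasSubgaussianMGF id v (gaussianReal 0 v) :=
    ⟨fun s => integrable_exp_mul_gaussianReal s, fun s => by simp [mgf_id_gaussianReal]⟩
  exact h.measure_ge_le ht

lemma gaussPi_dot_tail_le {ι : Type*} [Fintype ι] (v : NNReal) (x : ι → ℝ) {t : ℝ} (ht : 0 ≤ t) :
    (gaussPi ι v).real {u | t ≤ ∑ i, u i * x i} ≤
      Real.exp (-t ^ 2 / (2 * (v * ∑ i, x i ^ 2))) := by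
  have h := gaussianReal_tail_le (v * (∑ i, x i ^ 2).toNNReal) ht
  rw [← gaussPi_map_dot, map_measureReal_apply (by fun_prop)
    (measurableSet_le measurable_const measurable_id')] at h
  push_cast at h
  rwa [Real.coe_toNNReal _ (Finset.sum_nonneg fun i _ => sq_nonneg _)] at h

lemma gaussPi_dot_abs_tail_le {ι : Type*} [Fintype ι] (v : NNReal) (x : ι → ℝ) {t : ℝ}
    (ht : 0 ≤ t) :
    (gaussPi ι v).real {u | t ≤ |∑ i, u i * x i|} ≤
      2 * Real.exp (-t ^ 2 / (2 * (v * ∑ i, x i ^ 2))) := by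
  have h1 := gaussPi_dot_tail_le v x ht
  have h2 := gaussPi_dot_tail_le v (-x) ht
  simp only [Pi.neg_apply, even_two, Even.neg_pow] at h2
  have h3 : {u : ι → ℝ | t ≤ |∑ i, u i * x i|} ⊆
      {u | t ≤ ∑ i, u i * x i} ∪ {u | t ≤ ∑ i, u i * -x i} := by
    intro u hu
    simp only [Set.mem_ofPred_eq, Set.mem_union, mul_neg, Finset.sum_neg_distrib] at hu ⊢
    exact le_abs.1 hu
  have := (measureReal_mono (μ := gaussPi ι v) h3).trans (measureReal_union_le _ _)
  linarith

lemma integral_exp_sq_gaussianReal {v : NNReal} (hv : v ≠ 0) {t : ℝ} (ht : 2 * (t * v) < 1) :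
    ∫ x, Real.exp (t * x ^ 2) ∂(gaussianReal 0 v) = (√(1 - 2 * (t * v)))⁻¹ := by
  have hv' : (0 : ℝ) < v := by positivity
  rw [integral_gaussianReal_eq_integral_smul hv]
  have h : ∀ x : ℝ, gaussianPDFReal 0 v x • Real.exp (t * x ^ 2) =
      (√(2 * Real.pi * v))⁻¹ * Real.exp (-(1 / (2 * v) - t) * x ^ 2) := by
    intro x
    rw [gaussianPDFReal, smul_eq_mul, mul_assoc, ← Real.exp_add]
    congr 2
    field_simp
    ring
  simp_rw [h]
  rw [integral_const_mul, integral_gaussian, ← Real.sqrt_inv, ← Real.sqrt_inv, ← Real.sqrt_mul]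
  · congr 1
    have : 1 - 2 * (t * v) ≠ 0 := by linarith
    have : 1 / (2 * (v : ℝ)) - t ≠ 0 := by
      intro h0
      field_simp at h0
      apply this
      linarith
    have h4 : 1 - 2 * (t * v) = 2 * v * (1 / (2 * (v : ℝ)) - t) := by
      field_simp
    rw [h4]
    field_simp
  · positivity

lemma exp_neg_le_quadratic {z : ℝ} (hz : 0 ≤ z) : Real.exp (-z) ≤ 1 - z + z ^ 2 / 2 := by
  have h := Real.quadratic_le_exp_of_nonneg hz
  rw [Real.exp_neg, inv_le_comm₀ (Real.exp_pos _) (by nlinarith)]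
  refine le_trans ?_ h
  rw [inv_le_iff_one_le_mul₀ (by nlinarith)]
  nlinarith [sq_nonneg (z ^ 2)]

lemma exp_le_one_sub {s : ℝ} (hs : |s| ≤ 1 / 5) :
    Real.exp (-(2 * s + 4 * s ^ 2)) ≤ 1 - 2 * s := by
  obtain ⟨h1, h2⟩ := abs_le.1 hs
  rcases le_total 0 s with h | h
  · refine (exp_neg_le_quadratic (by positivity)).trans ?_
    nlinarith [mul_nonneg h h, mul_nonneg (mul_nonneg h h) h, mul_nonneg h (sub_nonneg.2 h2),
      mul_nonneg (mul_nonneg h h) (sub_nonneg.2 h2),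
      mul_nonneg (mul_nonneg (mul_nonneg h h) h) (sub_nonneg.2 h2)]
  · have h3 : Real.exp (2 * s + 4 * s ^ 2) ≥ (1 - 2 * s)⁻¹ := by
      have h4 : 0 ≤ -s := by linarith
      have h5 : -(2 * s + 4 * s ^ 2) ≤ Real.log (1 - 2 * s) := by
        have := Real.one_sub_inv_le_log_of_pos (x := (1 - 2 * s)) (by linarith)
        have h6 := Real.le_log_one_add_of_nonneg (x := -2 * s) (by linarith)
        refine le_trans ?_ (h6.trans (le_of_eq (by ring_nf)))
        rw [le_div_iff₀ (by linarith)]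
        nlinarith [mul_nonneg h4 h4, mul_nonneg (mul_nonneg h4 h4) h4]
      rw [ge_iff_le, inv_le_iff_one_le_mul₀ (by linarith)]
      calc (1 : ℝ) = Real.exp (2 * s + 4 * s ^ 2) * Real.exp (-(2 * s + 4 * s ^ 2)) := by
            rw [← Real.exp_add]; simp
        _ ≤ _ := by
            gcongr
            rw [← Real.exp_log (show 0 < 1 - 2 * s by linarith)]
            exact Real.exp_le_exp.2 h5
    rw [Real.exp_neg, inv_le_comm₀ (Real.exp_pos _) (by linarith)]
    exact h3

lemma integral_exp_sq_gaussianReal_le {v : NNReal} (hv : v ≠ 0) {t : ℝ} (ht : |t * v| ≤ 1 / 5) :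
    ∫ x, Real.exp (t * x ^ 2) ∂(gaussianReal 0 v) ≤
      Real.exp (t * v + 2 * (t * v) ^ 2) := by
  have h0 := abs_le.1 ht
  rw [integral_exp_sq_gaussianReal hv (by linarith), inv_le_comm₀
    (Real.sqrt_pos.2 (by linarith)) (Real.exp_pos _), ← Real.exp_neg]
  apply Real.le_sqrt_of_sq_le
  rw [← Real.exp_nat_mul]
  refine le_trans (le_of_eq ?_) (exp_le_one_sub ht)
  congr 1
  push_cast
  ring

lemma mgf_sum_sq_gaussPi {ι : Type*} [Fintype ι] {v : NNReal} (hv : v ≠ 0) {t : ℝ}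
    (ht : |t * v| ≤ 1 / 5) :
    Integrable (fun u : ι → ℝ => Real.exp (t * ∑ i, u i ^ 2)) (gaussPi ι v) ∧
    mgf (fun u : ι → ℝ => ∑ i, u i ^ 2) (gaussPi ι v) t ≤
      Real.exp (Fintype.card ι * (t * v + 2 * (t * v) ^ 2)) := by
  have h0 := abs_le.1 ht
  have h1 : ∀ u : ι → ℝ, Real.exp (t * ∑ i, u i ^ 2) = ∏ i, Real.exp (t * u i ^ 2) := by
    intro u
    rw [← Real.exp_sum, Finset.mul_sum]
  have h2 : Integrable (fun x => Real.exp (t * x ^ 2)) (gaussianReal 0 v) := by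
    refine not_imp_comm.1 integral_undef ?_
    rw [integral_exp_sq_gaussianReal hv (by linarith)]
    exact inv_ne_zero (Real.sqrt_pos.2 (by linarith)).ne'
  constructor
  · simp_rw [h1]
    exact Integrable.fintype_prod (f := fun _ x => Real.exp (t * x ^ 2)) fun _ => h2
  · rw [mgf]
    simp_rw [h1]
    rw [integral_fintype_prod_eq_pow (fun x => Real.exp (t * x ^ 2)), Real.exp_nat_mul]
    exact pow_le_pow_left₀ (integral_nonneg fun x => (Real.exp_pos _).le)
      (integral_exp_sq_gaussianReal_le hv ht) _

/-- Chi-squared concentration. -/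
lemma gaussPi_sum_sq_concentration {ι : Type*} [Fintype ι] {v : NNReal} (hv : v ≠ 0) {ε : ℝ}
    (hε : 0 < ε) (hε' : ε ≤ 4 / 5) :
    (gaussPi ι v).real {u | ε * (Fintype.card ι * v) ≤ |∑ i, u i ^ 2 - Fintype.card ι * v|} ≤
      2 * Real.exp (-(Fintype.card ι * ε ^ 2 / 8)) := by
  have hv' : (0 : ℝ) < v := by positivity
  set m : ℝ := (Fintype.card ι : ℝ)
  have key : ∀ t : ℝ, t * v = ε / 4 ∨ t * v = -(ε / 4) → |t * v| ≤ 1 / 5 := by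
    rintro t (h | h) <;> rw [h]
    · rw [abs_of_pos (by linarith)]; linarith
    · rw [abs_neg, abs_of_pos (by linarith)]; linarith
  have ht1 : (ε / (4 * v)) * v = ε / 4 := by field_simp
  have ht2 : (-(ε / (4 * v))) * v = -(ε / 4) := by field_simp
  obtain ⟨i1, m1⟩ := mgf_sum_sq_gaussPi (ι := ι) hv (key _ (Or.inl ht1))
  obtain ⟨i2, m2⟩ := mgf_sum_sq_gaussPi (ι := ι) hv (key _ (Or.inr ht2))
  have b1 := measure_ge_le_exp_mul_mgf (m * v + ε * (m * v)) (by positivity) i1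
  have b2 := measure_le_le_exp_mul_mgf (m * v - ε * (m * v))
    (neg_nonpos.2 (by positivity)) i2
  have c1 : Real.exp (-(ε / (4 * v)) * (m * v + ε * (m * v))) *
      mgf (fun u : ι → ℝ => ∑ i, u i ^ 2) (gaussPi ι v) (ε / (4 * v)) ≤
      Real.exp (-(m * ε ^ 2 / 8)) := by
    refine (mul_le_mul_of_nonneg_left m1 (Real.exp_pos _).le).trans ?_
    rw [← Real.exp_add, ht1]
    refine Real.exp_le_exp.2 (le_of_eq ?_)
    field_simp
    ring
  have c2 : Real.exp (-(-(ε / (4 * v))) * (m * v - ε * (m * v))) *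
      mgf (fun u : ι → ℝ => ∑ i, u i ^ 2) (gaussPi ι v) (-(ε / (4 * v))) ≤
      Real.exp (-(m * ε ^ 2 / 8)) := by
    refine (mul_le_mul_of_nonneg_left m2 (Real.exp_pos _).le).trans ?_
    rw [← Real.exp_add, ht2]
    refine Real.exp_le_exp.2 (le_of_eq ?_)
    field_simp
    ring
  have h3 : {u : ι → ℝ | ε * (m * v) ≤ |∑ i, u i ^ 2 - m * v|} ⊆
      {u | m * v + ε * (m * v) ≤ ∑ i, u i ^ 2} ∪ {u | ∑ i, u i ^ 2 ≤ m * v - ε * (m * v)} := by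
    intro u hu
    simp only [Set.mem_ofPred_eq, Set.mem_union] at hu ⊢
    rcases le_abs.1 hu with h | h
    · left; linarith
    · right; linarith
  have := (measureReal_mono (μ := gaussPi ι v) h3).trans (measureReal_union_le _ _)
  linarith

lemma le_gaussianReal_tail {v : NNReal} (hv : v ≠ 0) {b : ℝ} (hb : 0 ≤ b) :
    (√(2 * Real.pi))⁻¹ * Real.exp (-(b + 1) ^ 2 / 2) ≤
      (gaussianReal 0 v).real {x | √v * b ≤ x} := by
  have hv' : (0 : ℝ) < v := by positivity
  have hmap : (gaussianReal 0 v) = (gaussianReal 0 1).map (√v * ·) := by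
    rw [gaussianReal_map_const_mul]
    congr 1
    · simp
    · ext; simp [Real.sq_sqrt]
  rw [hmap, map_measureReal_apply (by fun_prop)
    (measurableSet_le measurable_const measurable_id')]
  have hsub : Set.Icc b (b + 1) ⊆ (√(v : ℝ) * ·) ⁻¹' {x | √v * b ≤ x} := by
    intro x hx
    exact mul_le_mul_of_nonneg_left hx.1 (Real.sqrt_nonneg _)
  refine le_trans ?_ (measureReal_mono hsub)
  rw [measureReal_def, gaussianReal_apply_eq_integral 0 one_ne_zero, ENNReal.toReal_ofReal
    (integral_nonneg fun x => gaussianPDFReal_nonneg _ _ _)]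
  have := setIntegral_ge_of_const_le_real (μ := volume) (s := Set.Icc b (b + 1))
    (f := gaussianPDFReal 0 1) (c := (√(2 * Real.pi))⁻¹ * Real.exp (-(b + 1) ^ 2 / 2))
    measurableSet_Icc (by simp) ?_ (integrable_gaussianPDFReal 0 1).integrableOn
  · simpa using this
  · intro x hx
    simp only [gaussianPDFReal, NNReal.coe_one, mul_one, sub_zero]
    gcongr
    · linarith [hx.1]
    · exact hx.2

lemma gaussianReal_real_le_neg (v : NNReal) (t : ℝ) :
    (gaussianReal 0 v).real {x | x ≤ -t} = (gaussianReal 0 v).real {x | t ≤ x} := by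
  have h : gaussianReal 0 v = (gaussianReal 0 v).map (fun x => -x) := by
    rw [gaussianReal_map_neg, neg_zero]
  conv_lhs => rw [h]
  rw [map_measureReal_apply (by fun_prop) (measurableSet_le measurable_id' measurable_const)]
  congr 1
  ext x
  simp

lemma prod_real_le {α β : Type*} [MeasurableSpace α] [MeasurableSpace β] (μ : Measure α)
    (ν : Measure β) [IsProbabilityMeasure μ] [IsProbabilityMeasure ν] {S : Set (α × β)}
    (hS : MeasurableSet S) {G : Set α} (hG : MeasurableSet G) {c : ℝ} (hc : 0 ≤ c)
    (h : ∀ x ∈ G, ν.real (Prod.mk x ⁻¹' S) ≤ c) :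
    (μ.prod ν).real S ≤ μ.real Gᶜ + c := by
  rw [measureReal_def, Measure.prod_apply hS]
  have h1 : ∫⁻ x, ν (Prod.mk x ⁻¹' S) ∂μ ≤
      ∫⁻ x, (Gᶜ.indicator 1 x + ENNReal.ofReal c) ∂μ := by
    refine lintegral_mono fun x => ?_
    by_cases hx : x ∈ G
    · refine le_trans ?_ le_add_self
      rw [← ofReal_measureReal]
      exact ENNReal.ofReal_le_ofReal (h x hx)
    · refine le_trans prob_le_one ?_
      simp [hx]
  rw [lintegral_add_right _ measurable_const, lintegral_indicator_one hG.compl,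
    lintegral_const, measure_univ, mul_one, ← ofReal_measureReal,
    ← ENNReal.ofReal_add measureReal_nonneg hc] at h1
  exact ENNReal.toReal_le_of_le_ofReal (add_nonneg measureReal_nonneg hc) h1

lemma le_prod_real {α β : Type*} [MeasurableSpace α] [MeasurableSpace β] (μ : Measure α)
    (ν : Measure β) [IsProbabilityMeasure μ] [IsProbabilityMeasure ν] {S : Set (α × β)}
    (hS : MeasurableSet S) {G : Set α} (hG : MeasurableSet G) {c : ℝ}
    (h : ∀ x ∈ G, c ≤ ν.real (Prod.mk x ⁻¹' S)) :
    μ.real G * c ≤ (μ.prod ν).real S := by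
  have h1 : ∫⁻ _ in G, ENNReal.ofReal c ∂μ ≤ ∫⁻ x, ν (Prod.mk x ⁻¹' S) ∂μ := by
    refine le_trans (setLIntegral_mono' hG fun x hx => ?_) (setLIntegral_le_lintegral G _)
    rw [← ofReal_measureReal]
    exact ENNReal.ofReal_le_ofReal (h x hx)
  rw [← Measure.prod_apply hS, setLIntegral_const] at h1
  have h2 := ENNReal.toReal_mono (measure_ne_top _ _) h1
  rw [ENNReal.toReal_mul, ENNReal.toReal_ofReal', mul_comm] at h2
  exact le_trans (mul_le_mul_of_nonneg_left (le_max_left _ _) measureReal_nonneg) h2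

/-- The failure event after conditioning on the memory: `h` is the vector of scores of the noise,
`e` the normalised weight vector and `r` the squared norm of the noise direction. -/
def reducedFail {κ : Type*} [Fintype κ] (i₀ : κ) (e : κ → ℝ) (r : ℝ) : Set (κ → ℝ) :=
  {h | ∃ j, j ≠ i₀ ∧
    h i₀ + e i₀ * (r - ∑ l, h l * e l) ≤ h j + e j * (r - ∑ l, h l * e l)}

lemma gaussPi_reducedFail_le {κ : Type*} [Fintype κ] (i₀ : κ) {e : κ → ℝ}
    (he : ∑ k, e k ^ 2 = 1) {r ε l : ℝ} (hε : 0 ≤ ε) (hε' : ε ≤ 1 / 4) (hr : |r - 1| ≤ ε)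
    (hl : 0 ≤ l) (hel : ∀ j, j ≠ i₀ → l ≤ e i₀ - e j) (w : NNReal) :
    (gaussPi κ w).real (reducedFail i₀ e r) ≤
      2 * Real.exp (-ε ^ 2 / (2 * w)) +
        Fintype.card κ * Real.exp (-(l * (1 - 2 * ε)) ^ 2 / (4 * w)) := by
  classical
  obtain ⟨hr1, hr2⟩ := abs_le.1 hr
  let B : κ → Set (κ → ℝ) := fun j =>
    {h | l * (1 - 2 * ε) ≤ ∑ k, h k * (Pi.single j 1 - Pi.single i₀ 1 : κ → ℝ) k}
  have hsub : reducedFail i₀ e r ⊆ {h | ε ≤ |∑ k, h k * e k|} ∪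
      ⋃ j ∈ (Finset.univ.erase i₀), B j := by
    intro h hh
    obtain ⟨j, hj, hle⟩ := hh
    by_cases hs : ε ≤ |∑ k, h k * e k|
    · exact Or.inl hs
    · right
      simp only [Set.mem_iUnion]
      refine ⟨j, by simp [hj], ?_⟩
      obtain ⟨h1, h2⟩ := abs_lt.1 (not_le.1 hs)
      change l * (1 - 2 * ε) ≤ _
      have : ∑ k, h k * (Pi.single j 1 - Pi.single i₀ 1 : κ → ℝ) k = h j - h i₀ := by
        simp [Pi.single_apply, mul_sub]
      rw [this]
      have h3 : l * (1 - 2 * ε) ≤ (e i₀ - e j) * (r - ∑ l, h l * e l) :=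
        mul_le_mul (hel j hj) (by linarith) (by linarith) (hl.trans (hel j hj))
      linarith
  have hB : ∀ j ∈ Finset.univ.erase i₀, (gaussPi κ w).real (B j) ≤
      Real.exp (-(l * (1 - 2 * ε)) ^ 2 / (4 * w)) := by
    intro j hj
    refine (gaussPi_dot_tail_le w _ (mul_nonneg hl (by linarith))).trans (le_of_eq ?_)
    have hj' : j ≠ i₀ := by simpa using hj
    have : ∑ k, ((Pi.single j 1 - Pi.single i₀ 1 : κ → ℝ) k) ^ 2 = 2 := by
      simp [Pi.single_apply, sub_sq, Finset.sum_add_distrib, Finset.sum_sub_distrib, hj'.symm]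
      norm_num
    rw [this]
    congr 2
    ring
  refine (measureReal_mono hsub).trans ((measureReal_union_le _ _).trans ?_)
  gcongr
  · have := gaussPi_dot_abs_tail_le w e hε
    rwa [he, mul_one] at this
  · refine (measureReal_biUnion_finset_le _ _).trans ((Finset.sum_le_sum hB).trans ?_)
    rw [Finset.sum_const, nsmul_eq_mul]
    gcongr
    exact Finset.card_le_univ _

lemma gaussPi_opposite_tails {κ : Type*} [Fintype κ] [DecidableEq κ] (i₀ : κ) (w : NNReal) {t p : ℝ}
    (hp : 0 ≤ p) (hpt : p ≤ (gaussianReal 0 w).real {x | t ≤ x}) :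
    p * (1 - (1 - p) ^ (Fintype.card κ - 1)) ≤
      (gaussPi κ w).real {h | h i₀ ≤ -t ∧ ∃ j, j ≠ i₀ ∧ t ≤ h j} := by
  set q := (gaussianReal 0 w).real {x | t ≤ x} with hq
  have hq1 : q ≤ 1 := measureReal_le_one
  let A : κ → Set ℝ := fun j => if j = i₀ then {x | x ≤ -t} else Set.univ
  let C : κ → Set ℝ := fun j => if j = i₀ then {x | x ≤ -t} else {x | t ≤ x}ᶜ
  have hA : (gaussPi κ w).real (Set.pi Set.univ A) = q := by
    rw [measureReal_def, Measure.pi_pi, ENNReal.toReal_prod, Finset.prod_eq_single i₀]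
    · simp only [A, if_true]
      exact gaussianReal_real_le_neg w t
    · intro j _ hj
      simp [A, hj]
    · simp
  have hC : (gaussPi κ w).real (Set.pi Set.univ C) = q * (1 - q) ^ (Fintype.card κ - 1) := by
    rw [measureReal_def, Measure.pi_pi, ENNReal.toReal_prod,
      ← Finset.mul_prod_erase _ _ (Finset.mem_univ i₀)]
    congr 1
    · simp only [C, if_true]
      exact gaussianReal_real_le_neg w t
    · rw [← Finset.card_univ, ← Finset.card_erase_of_mem (Finset.mem_univ i₀)]
      refine Finset.prod_eq_pow_card fun j hj => ?_
      have hj' : j ≠ i₀ := by simpa using hj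
      simp only [C, if_neg hj']
      rw [← measureReal_def, probReal_compl_eq_one_sub
        (measurableSet_le measurable_const measurable_id')]
  have hsub : Set.pi Set.univ A ⊆
      {h | h i₀ ≤ -t ∧ ∃ j, j ≠ i₀ ∧ t ≤ h j} ∪ Set.pi Set.univ C := by
    intro h hh
    have h0 : h i₀ ≤ -t := by
      have := hh i₀ (Set.mem_univ _)
      simpa [A] using this
    by_cases hj : ∃ j, j ≠ i₀ ∧ t ≤ h j
    · exact Or.inl ⟨h0, hj⟩
    · right
      intro j _
      by_cases hji : j = i₀
      · subst hji; simpa [C] using h0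
      · simp only [C, if_neg hji]
        exact fun hc => hj ⟨j, hji, hc⟩
  have h1 := (measureReal_mono (μ := gaussPi κ w) hsub).trans (measureReal_union_le _ _)
  rw [hA, hC] at h1
  have h2 : (1 - q) ^ (Fintype.card κ - 1) ≤ (1 - p) ^ (Fintype.card κ - 1) :=
    pow_le_pow_left₀ (by linarith) (by linarith) _
  have h3 : (1 - p) ^ (Fintype.card κ - 1) ≤ 1 := pow_le_one₀ (by linarith) (by linarith)
  have h4 : p * (1 - (1 - p) ^ (Fintype.card κ - 1)) ≤ q * (1 - (1 - q) ^ (Fintype.card κ - 1)) :=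
    mul_le_mul hpt (by linarith) (by linarith) (by linarith)
  linarith

lemma le_gaussPi_reducedFail {κ : Type*} [Fintype κ] (i₀ : κ) {e : κ → ℝ}
    (he : ∑ k, e k ^ 2 = 1) {r ε u t p : ℝ} (hε : 0 ≤ ε) (hr : |r - 1| ≤ ε) (hε' : ε ≤ 1 / 4)
    (heu : ∀ j, j ≠ i₀ → e i₀ - e j ≤ u) (hu : 0 ≤ u) (w : NNReal) (ht : u * (1 + 2 * ε) ≤ 2 * t)
    (hp : 0 ≤ p) (hpt : p ≤ (gaussianReal 0 w).real {x | t ≤ x}) :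
    p * (1 - (1 - p) ^ (Fintype.card κ - 1)) - 2 * Real.exp (-ε ^ 2 / (2 * w)) ≤
      (gaussPi κ w).real (reducedFail i₀ e r) := by
  classical
  obtain ⟨hr1, hr2⟩ := abs_le.1 hr
  have hsub : {h : κ → ℝ | h i₀ ≤ -t ∧ ∃ j, j ≠ i₀ ∧ t ≤ h j} ⊆
      reducedFail i₀ e r ∪ {h | ε ≤ |∑ k, h k * e k|} := by
    rintro h ⟨h0, j, hj, hjt⟩
    by_cases hs : ε ≤ |∑ k, h k * e k|
    · exact Or.inr hs
    · left
      refine ⟨j, hj, ?_⟩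
      obtain ⟨h1, h2⟩ := abs_lt.1 (not_le.1 hs)
      have h3 : (e i₀ - e j) * (r - ∑ l, h l * e l) ≤ u * (1 + 2 * ε) :=
        mul_le_mul (heu j hj) (by linarith) (by linarith) hu
      linarith
  have h1 := (gaussPi_opposite_tails i₀ w hp hpt).trans
    ((measureReal_mono hsub).trans (measureReal_union_le _ _))
  have h2 := gaussPi_dot_abs_tail_le w e hε
  rw [he, mul_one] at h2
  linarith

/-- The failure event for the item `i₀` when the weights in the memory are `a`. -/
def weightFail {ι κ : Type*} [Fintype ι] [Fintype κ] (i₀ : κ) (a : κ → ℝ) : Set (κ → ι → ℝ) :=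
  {u | ∃ j, j ≠ i₀ ∧ ∑ i, u i₀ i * ∑ k, a k * u k i ≤ ∑ i, u j i * ∑ k, a k * u k i}

lemma measurableSet_reducedFail_dot {ι κ : Type*} [Fintype ι] [Fintype κ] (i₀ : κ) (e : κ → ℝ) :
    MeasurableSet {p : (ι → ℝ) × (κ → ι → ℝ) |
      (fun k => ∑ i, p.2 k i * p.1 i) ∈ reducedFail i₀ e (∑ i, p.1 i ^ 2)} := by
  have : {p : (ι → ℝ) × (κ → ι → ℝ) |
      (fun k => ∑ i, p.2 k i * p.1 i) ∈ reducedFail i₀ e (∑ i, p.1 i ^ 2)} =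
      ⋃ j, ⋃ (_ : j ≠ i₀), {p : (ι → ℝ) × (κ → ι → ℝ) |
        (∑ i, p.2 i₀ i * p.1 i) +
          e i₀ * (∑ i, p.1 i ^ 2 - ∑ l, (∑ i, p.2 l i * p.1 i) * e l) ≤
        (∑ i, p.2 j i * p.1 i) +
          e j * (∑ i, p.1 i ^ 2 - ∑ l, (∑ i, p.2 l i * p.1 i) * e l)} := by
    ext p
    simp [reducedFail]
  rw [this]
  refine MeasurableSet.iUnion fun j => MeasurableSet.iUnion fun _ => ?_
  exact measurableSet_le (by fun_prop) (by fun_prop)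

lemma measurableSet_reducedFail {κ : Type*} [Fintype κ] (i₀ : κ) (e : κ → ℝ) (r : ℝ) :
    MeasurableSet (reducedFail i₀ e r) := by
  have : reducedFail i₀ e r = ⋃ j, ⋃ (_ : j ≠ i₀), {h : κ → ℝ |
      h i₀ + e i₀ * (r - ∑ l, h l * e l) ≤ h j + e j * (r - ∑ l, h l * e l)} := by
    ext p
    simp [reducedFail]
  rw [this]
  refine MeasurableSet.iUnion fun j => MeasurableSet.iUnion fun _ => ?_
  exact measurableSet_le (by fun_prop) (by fun_prop)

lemma measurableSet_weightFail {ι κ : Type*} [Fintype ι] [Fintype κ] (i₀ : κ) (a : κ → ℝ) :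
    MeasurableSet (weightFail (ι := ι) i₀ a) := by
  have : weightFail (ι := ι) i₀ a = ⋃ j, ⋃ (_ : j ≠ i₀), {u : κ → ι → ℝ |
      ∑ i, u i₀ i * ∑ k, a k * u k i ≤ ∑ i, u j i * ∑ k, a k * u k i} := by
    ext p
    simp [weightFail]
  rw [this]
  refine MeasurableSet.iUnion fun j => MeasurableSet.iUnion fun _ => ?_
  exact measurableSet_le (by fun_prop) (by fun_prop)

lemma resample_mem_weightFail_iff {ι κ : Type*} [Fintype ι] [Fintype κ] (i₀ : κ) (e : κ → ℝ)
    (he : ∑ k, e k ^ 2 = 1) {A : ℝ} (hA : 0 < A) (p : (ι → ℝ) × (κ → ι → ℝ)) :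
    resample e p ∈ weightFail i₀ (fun k => A * e k) ↔
      (fun k => ∑ i, p.2 k i * p.1 i) ∈ reducedFail i₀ e (∑ i, p.1 i ^ 2) := by
  have h1 : ∀ i, ∑ k, A * e k * resample e p k i = A * p.1 i := by
    intro i
    have : ∀ k, A * e k * resample e p k i = A * (e k * p.2 k i) +
        A * (p.1 i - ∑ l, e l * p.2 l i) * e k ^ 2 := by
      intro k
      simp only [resample]
      ring
    simp_rw [this]
    rw [Finset.sum_add_distrib, ← Finset.mul_sum, ← Finset.mul_sum, he]
    ring
  have h2 : ∀ j, ∑ i, resample e p j i * (A * p.1 i) = A * ((∑ i, p.2 j i * p.1 i) +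
      e j * (∑ i, p.1 i ^ 2 - ∑ l, (∑ i, p.2 l i * p.1 i) * e l)) := by
    intro j
    have h3 : ∑ l, (∑ i, p.2 l i * p.1 i) * e l = ∑ i, (∑ l, e l * p.2 l i) * p.1 i := by
      simp_rw [Finset.sum_mul]
      rw [Finset.sum_comm]
      refine Finset.sum_congr rfl fun i _ => Finset.sum_congr rfl fun l _ => ?_
      ring
    rw [h3, mul_add, ← mul_assoc A (e j), ← Finset.sum_sub_distrib, Finset.mul_sum,
      Finset.mul_sum, ← Finset.sum_add_distrib]
    refine Finset.sum_congr rfl fun i _ => ?_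
    simp only [resample]
    ring
  change (∃ j, j ≠ i₀ ∧ _) ↔ ∃ j, j ≠ i₀ ∧ _
  refine exists_congr fun j => and_congr_right fun _ => ?_
  simp_rw [h1, h2]
  exact mul_le_mul_iff_right₀ hA

lemma measurable_resample {ι κ : Type*} [Fintype κ] (e : κ → ℝ) :
    Measurable (resample (ι := ι) e) := by
  unfold resample
  fun_prop

lemma weightFail_real_eq {ι κ : Type*} [Fintype ι] [Fintype κ] (i₀ : κ) (v : NNReal) (e : κ → ℝ)
    (he : ∑ k, e k ^ 2 = 1) {A : ℝ} (hA : 0 < A) :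
    (Measure.pi fun _ : κ => gaussPi ι v).real (weightFail i₀ fun k => A * e k) =
      ((gaussPi ι v).prod (Measure.pi fun _ : κ => gaussPi ι v)).real
        {p | (fun k => ∑ i, p.2 k i * p.1 i) ∈ reducedFail i₀ e (∑ i, p.1 i ^ 2)} := by
  conv_lhs => rw [← map_resample v e he]
  rw [map_measureReal_apply (measurable_resample e) (measurableSet_weightFail _ _)]
  congr 1
  ext p
  exact resample_mem_weightFail_iff i₀ e he hA p

lemma pi_gaussPi_dot_real {ι κ : Type*} [Fintype ι] [Fintype κ] (v : NNReal) (y : ι → ℝ)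
    {S : Set (κ → ℝ)} (hS : MeasurableSet S) :
    (Measure.pi fun _ : κ => gaussPi ι v).real {U | (fun k => ∑ i, U k i * y i) ∈ S} =
      (gaussPi κ (v * (∑ i, y i ^ 2).toNNReal)).real S := by
  have h1 : (Measure.pi fun _ : κ => gaussPi ι v).map (fun U k => ∑ i, U k i * y i) =
      gaussPi κ (v * (∑ i, y i ^ 2).toNNReal) := by
    have hs : ∀ _ : κ, SigmaFinite ((gaussPi ι v).map (fun u => ∑ i, u i * y i)) := by
      intro k
      rw [gaussPi_map_dot]
      infer_instance
    refine (Measure.pi_map_pi (μ := fun _ : κ => gaussPi ι v)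
      (f := fun (_ : κ) (u : ι → ℝ) => ∑ i, u i * y i)
      (fun _ => Measurable.aemeasurable (by fun_prop))).trans ?_
    simp_rw [gaussPi_map_dot]
  rw [← h1, map_measureReal_apply (by fun_prop) hS]
  rfl

lemma gaussPi_norm_sq_concentration {ι : Type*} [Fintype ι] {v : NNReal}
    (hv : (Fintype.card ι : ℝ) * v = 1) {ε : ℝ} (hε : 0 < ε) (hε' : ε ≤ 1 / 4) :
    (gaussPi ι v).real {y | |∑ i, y i ^ 2 - 1| < ε}ᶜ ≤
      2 * Real.exp (-(Fintype.card ι * ε ^ 2 / 8)) := by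
  have hv0 : v ≠ 0 := by
    rintro rfl
    simp at hv
  have := gaussPi_sum_sq_concentration (ι := ι) hv0 hε (by linarith)
  rw [hv, mul_one] at this
  refine le_trans (le_of_eq ?_) this
  congr 1
  ext y
  simp

/-- The weights are close to their typical values. -/
structure GoodWeights {κ : Type*} [Fintype κ] (i₀ : κ) (ε lo hi : ℝ) (a : κ → ℝ) : Prop where
  self : |a i₀ - 1| ≤ ε
  other : ∀ j, j ≠ i₀ → |a j| ≤ ε
  lower : lo ≤ ∑ k, a k ^ 2
  upper : ∑ k, a k ^ 2 ≤ hi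

lemma GoodWeights.normalize {κ : Type*} [Fintype κ] {i₀ : κ} {ε lo hi : ℝ} {a : κ → ℝ}
    (ha : GoodWeights i₀ ε lo hi a) (hlo : 0 < lo) :
    ∃ (A : ℝ) (e : κ → ℝ), 0 < A ∧ A ^ 2 = ∑ k, a k ^ 2 ∧ ∑ k, e k ^ 2 = 1 ∧
      (a = fun k => A * e k) ∧ (∀ j, j ≠ i₀ → (1 - 2 * ε) / A ≤ e i₀ - e j) ∧
      ∀ j, j ≠ i₀ → e i₀ - e j ≤ (1 + 2 * ε) / A := by
  have hpos : 0 < ∑ k, a k ^ 2 := hlo.trans_le ha.lower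
  have hA := Real.sqrt_pos.2 hpos
  have hsq := Real.sq_sqrt hpos.le
  obtain ⟨s1, s2⟩ := abs_le.1 ha.self
  refine ⟨√(∑ k, a k ^ 2), fun k => a k / √(∑ k, a k ^ 2), hA, hsq, ?_, ?_, ?_, ?_⟩
  · simp_rw [div_pow]
    rw [← Finset.sum_div, hsq, div_self hpos.ne']
  · ext k
    field_simp
  · intro j hj
    obtain ⟨o1, o2⟩ := abs_le.1 (ha.other j hj)
    rw [← sub_div]
    exact div_le_div_of_nonneg_right (by linarith) hA.le
  · intro j hj
    obtain ⟨o1, o2⟩ := abs_le.1 (ha.other j hj)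
    rw [← sub_div]
    exact div_le_div_of_nonneg_right (by linarith) hA.le

lemma weightFail_le {ι κ : Type*} [Fintype ι] [Fintype κ] {i₀ : κ} {v : NNReal}
    (hv : (Fintype.card ι : ℝ) * v = 1) {ε lo hi : ℝ} (hε : 0 < ε) (hε' : ε ≤ 1 / 4) (hlo : 0 < lo)
    {a : κ → ℝ} (ha : GoodWeights i₀ ε lo hi a) :
    (Measure.pi fun _ : κ => gaussPi ι v).real (weightFail i₀ a) ≤
      2 * Real.exp (-(Fintype.card ι * ε ^ 2 / 8)) + (2 * Real.exp (-ε ^ 2 / (4 * v)) +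
        Fintype.card κ * Real.exp (-(1 - 2 * ε) ^ 4 / (4 * ((1 + ε) * v * hi)))) := by
  obtain ⟨A, e, hA, hA2, he, rfl, hl, -⟩ := ha.normalize hlo
  have hv0 : (0 : ℝ) < v := by
    rcases (NNReal.coe_nonneg v).eq_or_lt with h | h
    · simp [← h] at hv
    · exact h
  rw [weightFail_real_eq i₀ v e he hA]
  refine (prod_real_le _ _ (measurableSet_reducedFail_dot i₀ e)
    (G := {y | |∑ i, y i ^ 2 - 1| < ε}) (measurableSet_lt (by fun_prop) (by fun_prop))
    (c := 2 * Real.exp (-ε ^ 2 / (4 * v)) +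
        Fintype.card κ * Real.exp (-(1 - 2 * ε) ^ 4 / (4 * ((1 + ε) * v * hi))))
    (by positivity) ?_).trans ?_
  · intro y hy
    have hy' : |∑ i, y i ^ 2 - 1| < ε := hy
    obtain ⟨hr1, hr2⟩ := abs_lt.1 hy'
    have hr0 : 0 ≤ ∑ i, y i ^ 2 := Finset.sum_nonneg fun i _ => sq_nonneg _
    refine (le_of_eq ?_).trans ((pi_gaussPi_dot_real (κ := κ) v y
      (measurableSet_reducedFail i₀ e (∑ i, y i ^ 2))).le.trans ?_)
    · congr 1
    refine (gaussPi_reducedFail_le i₀ he hε.le hε' hy'.le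
      (div_nonneg (by linarith) hA.le) hl _).trans ?_
    push_cast
    rw [Real.coe_toNNReal _ hr0]
    have hrpos : 0 < ∑ i, y i ^ 2 := by linarith
    have hup := ha.upper
    rw [← hA2] at hup
    gcongr 2 * Real.exp ?_ + _ * Real.exp ?_
    · rw [neg_div, neg_div, neg_le_neg_iff]
      exact div_le_div_of_nonneg_left (sq_nonneg _) (by positivity) (by nlinarith)
    · rw [neg_div, neg_div, neg_le_neg_iff]
      have : ((1 - 2 * ε) / A * (1 - 2 * ε)) ^ 2 / (4 * (v * ∑ i, y i ^ 2)) =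
          (1 - 2 * ε) ^ 4 / (4 * ((∑ i, y i ^ 2) * v * A ^ 2)) := by
        field_simp
      rw [this]
      gcongr
      linarith
  · gcongr
    exact gaussPi_norm_sq_concentration hv hε hε'

lemma le_weightFail {ι κ : Type*} [Fintype ι] [Fintype κ] {i₀ : κ} {v : NNReal}
    (hv : (Fintype.card ι : ℝ) * v = 1) {ε lo hi : ℝ} (hε : 0 < ε) (hε' : ε ≤ 1 / 4) (hlo : 0 < lo)
    {a : κ → ℝ} (ha : GoodWeights i₀ ε lo hi a) {b p : ℝ} (hb : 0 ≤ b)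
    (hbε : (1 + 2 * ε) ^ 2 ≤ 2 * ((1 - ε) * √v * b * √lo)) (hp : 0 ≤ p)
    (hpb : p ≤ (√(2 * Real.pi))⁻¹ * Real.exp (-(b + 1) ^ 2 / 2))
    (hc : 0 ≤ p * (1 - (1 - p) ^ (Fintype.card κ - 1)) - 2 * Real.exp (-ε ^ 2 / (4 * v))) :
    (1 - 2 * Real.exp (-(Fintype.card ι * ε ^ 2 / 8))) *
      (p * (1 - (1 - p) ^ (Fintype.card κ - 1)) - 2 * Real.exp (-ε ^ 2 / (4 * v))) ≤
      (Measure.pi fun _ : κ => gaussPi ι v).real (weightFail i₀ a) := by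
  obtain ⟨A, e, hA, hA2, he, rfl, -, hu⟩ := ha.normalize hlo
  have hv0 : (0 : ℝ) < v := by
    rcases (NNReal.coe_nonneg v).eq_or_lt with h | h
    · simp [← h] at hv
    · exact h
  have hG : MeasurableSet {y : ι → ℝ | |∑ i, y i ^ 2 - 1| < ε} :=
    measurableSet_lt (by fun_prop) (by fun_prop)
  rw [weightFail_real_eq i₀ v e he hA]
  refine le_trans ?_ (le_prod_real _ _ (measurableSet_reducedFail_dot i₀ e) hG
    (c := p * (1 - (1 - p) ^ (Fintype.card κ - 1)) - 2 * Real.exp (-ε ^ 2 / (4 * v))) ?_)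
  · refine mul_le_mul_of_nonneg_right ?_ hc
    have := gaussPi_norm_sq_concentration hv hε hε'
    rw [probReal_compl_eq_one_sub hG] at this
    linarith
  · intro y hy
    have hy' : |∑ i, y i ^ 2 - 1| < ε := hy
    obtain ⟨hr1, hr2⟩ := abs_lt.1 hy'
    have hr0 : 0 ≤ ∑ i, y i ^ 2 := Finset.sum_nonneg fun i _ => sq_nonneg _
    have hrpos : 0 < ∑ i, y i ^ 2 := by linarith
    refine le_trans ?_ ((pi_gaussPi_dot_real (κ := κ) v y
      (measurableSet_reducedFail i₀ e (∑ i, y i ^ 2))).symm.le.trans (le_of_eq ?_))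
    swap
    · congr 1
    set w : NNReal := v * (∑ i, y i ^ 2).toNNReal with hw
    have hwr : (w : ℝ) = v * ∑ i, y i ^ 2 := by
      rw [hw]; push_cast; rw [Real.coe_toNNReal _ hr0]
    have hw0 : w ≠ 0 := by
      have : (0 : ℝ) < w := by rw [hwr]; positivity
      exact_mod_cast this.ne'
    have hlow := ha.lower
    rw [← hA2] at hlow
    have hAlo : √lo ≤ A := by
      rw [← Real.sqrt_sq hA.le]
      exact Real.sqrt_le_sqrt hlow
    have hsw : (1 - ε) * √v ≤ √w := by
      rw [hwr]
      apply Real.le_sqrt_of_sq_le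
      rw [mul_pow, Real.sq_sqrt hv0.le, mul_comm]
      gcongr
      nlinarith
    refine le_trans ?_ (le_gaussPi_reducedFail i₀ he hε.le hy'.le hε' hu (by positivity) w
      (t := √w * b) ?_ hp (hpb.trans (le_gaussianReal_tail hw0 hb)))
    · rw [hwr]
      gcongr ?_ - 2 * Real.exp ?_
      rw [neg_div, neg_div, neg_le_neg_iff]
      exact div_le_div_of_nonneg_left (sq_nonneg _) (by positivity) (by nlinarith)
    · have h1 : (1 - ε) * √v * b * √lo ≤ √w * b * A := by gcongr
      rw [div_mul_eq_mul_div, div_le_iff₀ hA]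
      nlinarith

lemma gaussPi_coord_abs_tail_le {κ : Type*} [Fintype κ] (w : NNReal) (k : κ) {t : ℝ} (ht : 0 ≤ t) :
    (gaussPi κ w).real {h | t ≤ |h k|} ≤ 2 * Real.exp (-t ^ 2 / (2 * w)) := by
  classical
  have h := gaussPi_dot_abs_tail_le w (Pi.single k 1) ht
  simpa [Pi.single_apply] using h

/-- Typical values of `⟨v_k, v_0⟩`, `k ≠ 0`, when `⟨v_0, v_0⟩ = R`. -/
def typicalDots (N : ℕ) (v : NNReal) (ε R : ℝ) : Set (Fin N → ℝ) :=
  {h | (∀ k, |h k| ≤ ε) ∧ (1 - ε) ^ 2 * (N * v) ≤ R ^ 2 + ∑ k, h k ^ 2 ∧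
    R ^ 2 + ∑ k, h k ^ 2 ≤ (1 + ε) ^ 2 * (1 + N * v)}

lemma measurableSet_typicalDots_dot {ι : Type*} [Fintype ι] (N : ℕ) (v : NNReal) (ε : ℝ) :
    MeasurableSet {p : (ι → ℝ) × (Fin N → ι → ℝ) | |∑ i, p.1 i ^ 2 - 1| ≤ ε ∧
      (fun k => ∑ i, p.2 k i * p.1 i) ∈ typicalDots N v ε (∑ i, p.1 i ^ 2)} := by
  have : {p : (ι → ℝ) × (Fin N → ι → ℝ) | |∑ i, p.1 i ^ 2 - 1| ≤ ε ∧
      (fun k => ∑ i, p.2 k i * p.1 i) ∈ typicalDots N v ε (∑ i, p.1 i ^ 2)} =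
      {p | |∑ i, p.1 i ^ 2 - 1| ≤ ε} ∩ ((⋂ k, {p | |∑ i, p.2 k i * p.1 i| ≤ ε}) ∩
        ({p | (1 - ε) ^ 2 * (N * v) ≤ (∑ i, p.1 i ^ 2) ^ 2 + ∑ k, (∑ i, p.2 k i * p.1 i) ^ 2} ∩
          {p | (∑ i, p.1 i ^ 2) ^ 2 + ∑ k, (∑ i, p.2 k i * p.1 i) ^ 2 ≤
            (1 + ε) ^ 2 * (1 + N * v)})) := by
    ext p
    simp [typicalDots]
  rw [this]
  exact (measurableSet_le (by fun_prop) (by fun_prop)).inter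
    ((MeasurableSet.iInter fun k => measurableSet_le (by fun_prop) (by fun_prop)).inter
      ((measurableSet_le (by fun_prop) (by fun_prop)).inter
        (measurableSet_le (by fun_prop) (by fun_prop))))

lemma measurableSet_typicalDots (N : ℕ) (v : NNReal) (ε R : ℝ) :
    MeasurableSet (typicalDots N v ε R) := by
  have : typicalDots N v ε R = (⋂ k, {h | |h k| ≤ ε}) ∩
        ({h | (1 - ε) ^ 2 * (N * v) ≤ R ^ 2 + ∑ k, h k ^ 2} ∩
          {h | R ^ 2 + ∑ k, h k ^ 2 ≤ (1 + ε) ^ 2 * (1 + N * v)}) := by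
    ext h
    simp [typicalDots]
  rw [this]
  exact (MeasurableSet.iInter fun k => measurableSet_le (by fun_prop) (by fun_prop)).inter
      ((measurableSet_le (by fun_prop) (by fun_prop)).inter
        (measurableSet_le (by fun_prop) (by fun_prop)))

lemma gaussPi_atypical_le {N : ℕ} (hN : 0 < N) {v : NNReal} (hv : 0 < v) {ε R : ℝ} (hε : 0 < ε)
    (hε' : ε ≤ 1 / 4) (hR : |R - 1| < ε) :
    (gaussPi (Fin N) (v * R.toNNReal)).real (typicalDots N v ε R)ᶜ ≤
      N * (2 * Real.exp (-ε ^ 2 / (4 * v))) + 2 * Real.exp (-(N * ε ^ 2 / 8)) := by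
  obtain ⟨hR1, hR2⟩ := abs_lt.1 hR
  have hR0 : 0 < R := by linarith
  set w : NNReal := v * R.toNNReal with hw
  have hwr : (w : ℝ) = v * R := by
    rw [hw]; push_cast; rw [Real.coe_toNNReal _ hR0.le]
  have hv' : (0 : ℝ) < v := by exact_mod_cast hv
  have hw0 : w ≠ 0 := by
    have : (0 : ℝ) < w := by rw [hwr]; positivity
    exact_mod_cast this.ne'
  have hN' : (0 : ℝ) < N := by exact_mod_cast hN
  have hsub : (typicalDots N v ε R)ᶜ ⊆
      (⋃ k, {h | ε ≤ |h k|}) ∪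
        {h | ε * (Fintype.card (Fin N) * w) ≤ |∑ k, h k ^ 2 - Fintype.card (Fin N) * w|} := by
    intro h hh
    by_contra hc
    apply hh
    have h1 : ∀ k, |h k| < ε := fun k => by
      by_contra hk
      exact hc (Or.inl (Set.mem_iUnion.2 ⟨k, not_lt.1 hk⟩))
    have h2 : |∑ k, h k ^ 2 - Fintype.card (Fin N) * w| < ε * (Fintype.card (Fin N) * w) := by
      by_contra hk
      exact hc (Or.inr (not_lt.1 hk))
    rw [Fintype.card_fin, hwr] at h2
    obtain ⟨h3, h4⟩ := abs_lt.1 h2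
    have hNv : 0 < N * (v : ℝ) := by positivity
    refine ⟨fun k => (h1 k).le, ?_, ?_⟩
    · have : (1 - ε) * (N * v) * (1 - ε) ≤ (1 - ε) * (N * v) * R :=
        mul_le_mul_of_nonneg_left (by linarith) (mul_nonneg (by linarith) hNv.le)
      nlinarith [sq_nonneg R]
    · have : (1 + ε) * (N * v) * R ≤ (1 + ε) * (N * v) * (1 + ε) :=
        mul_le_mul_of_nonneg_left (by linarith) (mul_nonneg (by linarith) hNv.le)
      nlinarith
  refine (measureReal_mono hsub).trans ((measureReal_union_le _ _).trans (add_le_add ?_ ?_))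
  · refine (measureReal_iUnion_fintype_le _).trans ?_
    have : ∀ k, (gaussPi (Fin N) w).real {h | ε ≤ |h k|} ≤
        2 * Real.exp (-ε ^ 2 / (4 * v)) := by
      intro k
      refine (gaussPi_coord_abs_tail_le w k hε.le).trans ?_
      rw [hwr]
      gcongr 2 * Real.exp ?_
      rw [neg_div, neg_div, neg_le_neg_iff]
      exact div_le_div_of_nonneg_left (sq_nonneg _) (by positivity) (by nlinarith)
    refine (Finset.sum_le_sum fun k _ => this k).trans ?_
    simp
  · have := gaussPi_sum_sq_concentration (ι := Fin N) hw0 hε (by linarith)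
    rwa [Fintype.card_fin] at this ⊢

lemma measurableSet_goodWeights {ι : Type*} [Fintype ι] {N : ℕ} (ε lo hi : ℝ) :
    MeasurableSet {V : Fin (N + 1) → ι → ℝ |
      GoodWeights 0 ε lo hi fun k => ∑ r, V k r * V 0 r} := by
  have : {V : Fin (N + 1) → ι → ℝ | GoodWeights 0 ε lo hi fun k => ∑ r, V k r * V 0 r} =
      {V | |∑ r, V 0 r * V 0 r - 1| ≤ ε} ∩ ((⋂ j, ⋂ (_ : j ≠ 0), {V | |∑ r, V j r * V 0 r| ≤ ε}) ∩
        ({V | lo ≤ ∑ k, (∑ r, V k r * V 0 r) ^ 2} ∩ {V | ∑ k, (∑ r, V k r * V 0 r) ^ 2 ≤ hi})) := by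
    ext V
    simp only [Set.mem_inter_iff, Set.mem_iInter, Set.mem_ofPred_eq]
    exact ⟨fun h => ⟨h.1, h.2, h.3, h.4⟩, fun h => ⟨h.1, h.2.1, h.2.2.1, h.2.2.2⟩⟩
  rw [this]
  refine MeasurableSet.inter (measurableSet_le (by fun_prop) (by fun_prop))
    (MeasurableSet.inter (MeasurableSet.iInter fun j => MeasurableSet.iInter fun _ =>
      measurableSet_le (by fun_prop) (by fun_prop)) (MeasurableSet.inter
        (measurableSet_le (by fun_prop) (by fun_prop))
        (measurableSet_le (by fun_prop) (by fun_prop))))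

lemma not_goodWeights_le {ι : Type*} [Fintype ι] {N : ℕ} (hN : 0 < N) {v : NNReal}
    (hv : (Fintype.card ι : ℝ) * v = 1) {ε : ℝ} (hε : 0 < ε) (hε' : ε ≤ 1 / 4) :
    (Measure.pi fun _ : Fin (N + 1) => gaussPi ι v).real {V | GoodWeights 0 ε
      ((1 - ε) ^ 2 * (N * v)) ((1 + ε) ^ 2 * (1 + N * v)) fun k => ∑ r, V k r * V 0 r}ᶜ ≤
      2 * Real.exp (-(Fintype.card ι * ε ^ 2 / 8)) +
        (N * (2 * Real.exp (-ε ^ 2 / (4 * v))) + 2 * Real.exp (-(N * ε ^ 2 / 8))) := by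
  have hv0 : 0 < v := by
    rw [pos_iff_ne_zero]
    rintro rfl
    simp at hv
  set T : Set ((ι → ℝ) × (Fin N → ι → ℝ)) := {p | |∑ i, p.1 i ^ 2 - 1| ≤ ε ∧
      (fun k => ∑ i, p.2 k i * p.1 i) ∈ typicalDots N v ε (∑ i, p.1 i ^ 2)} with hT
  have hTm : MeasurableSet T := measurableSet_typicalDots_dot N v ε
  have hmp := measurePreserving_piFinSuccAbove (fun _ : Fin (N + 1) => gaussPi ι v) 0
  have hsub : {V : Fin (N + 1) → ι → ℝ | GoodWeights 0 ε
      ((1 - ε) ^ 2 * (N * v)) ((1 + ε) ^ 2 * (1 + N * v)) fun k => ∑ r, V k r * V 0 r}ᶜ ⊆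
      MeasurableEquiv.piFinSuccAbove (fun _ => ι → ℝ) 0 ⁻¹' Tᶜ := by
    intro V hV hVT
    apply hV
    obtain ⟨h1, h2, h3, h4⟩ : |∑ i, V 0 i ^ 2 - 1| ≤ ε ∧
        (∀ k : Fin N, |∑ i, V k.succ i * V 0 i| ≤ ε) ∧
        (1 - ε) ^ 2 * (N * v) ≤ (∑ i, V 0 i ^ 2) ^ 2 + ∑ k : Fin N, (∑ i, V k.succ i * V 0 i) ^ 2 ∧
          (∑ i, V 0 i ^ 2) ^ 2 + ∑ k : Fin N, (∑ i, V k.succ i * V 0 i) ^ 2 ≤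
            (1 + ε) ^ 2 * (1 + N * v) := hVT
    have h0 : ∑ r, V 0 r * V 0 r = ∑ i, V 0 i ^ 2 := by simp_rw [pow_two]
    refine ⟨?_, ?_, ?_, ?_⟩
    · rwa [h0]
    · intro j hj
      obtain ⟨k, rfl⟩ := Fin.exists_succ_eq.2 hj
      exact h2 k
    · rwa [Fin.sum_univ_succ, h0]
    · rwa [Fin.sum_univ_succ, h0]
  refine (measureReal_mono hsub).trans ?_
  rw [measureReal_def, hmp.measure_preimage hTm.compl.nullMeasurableSet, ← measureReal_def]
  refine (prod_real_le _ _ hTm.compl (G := {y | |∑ i, y i ^ 2 - 1| < ε})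
    (measurableSet_lt (by fun_prop) (by fun_prop)) (c := N * (2 * Real.exp (-ε ^ 2 / (4 * v))) +
      2 * Real.exp (-(N * ε ^ 2 / 8))) (by positivity) ?_).trans ?_
  · intro y hy
    have hy' : |∑ i, y i ^ 2 - 1| < ε := hy
    refine (le_of_eq ?_).trans ((pi_gaussPi_dot_real (κ := Fin N) v y
      (measurableSet_typicalDots N v ε (∑ i, y i ^ 2)).compl).le.trans
        (gaussPi_atypical_le hN hv0 hε hε' hy'))
    congr 1
    ext U
    simp [hT, hy'.le]
  · gcongr
    exact gaussPi_norm_sq_concentration hv hε hε'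

lemma scoreX_eq {d n : ℕ} (u v : Fin n → Fin d → ℝ) (j i : Fin n) :
    scoreX u v j i = ∑ r, u j r * ∑ k, (∑ s, v k s * v i s) * u k r := by
  simp only [scoreX, Wcross, dotProduct, Matrix.mulVec, Matrix.of_apply]
  refine Finset.sum_congr rfl fun r _ => ?_
  congr 1
  simp_rw [Finset.sum_mul]
  rw [Finset.sum_comm]
  refine Finset.sum_congr rfl fun k _ => Finset.sum_congr rfl fun s _ => ?_
  ring

lemma mem_failSet_iff {d N : ℕ} (u v : Fin (N + 1) → Fin d → ℝ) :
    (u, v) ∈ failSet d (N + 1) 0 ↔ u ∈ weightFail 0 fun k => ∑ s, v k s * v 0 s := by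
  simp only [failSet, weightFail, Set.mem_ofPred_eq, scoreX_eq]
  constructor
  · rintro ⟨i, j, hi, hj⟩
    obtain rfl : i = 0 := Fin.ext hi
    exact ⟨j, hj⟩
  · rintro ⟨j, hj⟩
    exact ⟨0, j, rfl, hj⟩

lemma measurableSet_failSet (d n i₀ : ℕ) : MeasurableSet (failSet d n i₀) := by
  have : failSet d n i₀ = ⋃ i : Fin n, ⋃ j : Fin n, ⋃ (_ : (i : ℕ) = i₀ ∧ j ≠ i),
      {p | scoreX p.1 p.2 i i ≤ scoreX p.1 p.2 j i} := by
    ext p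
    simp [failSet]
  rw [this]
  refine MeasurableSet.iUnion fun i => MeasurableSet.iUnion fun j =>
    MeasurableSet.iUnion fun _ => ?_
  simp_rw [scoreX_eq]
  exact measurableSet_le (by fun_prop) (by fun_prop)

lemma gaussianModel_real_failSet (d N : ℕ) :
    (gaussianModel d (N + 1)).real (failSet d (N + 1) 0) =
      ((Measure.pi fun _ : Fin (N + 1) => gaussPi (Fin d) (d : NNReal)⁻¹).prod
        (Measure.pi fun _ : Fin (N + 1) => gaussPi (Fin d) (d : NNReal)⁻¹)).real
          (Prod.swap ⁻¹' failSet d (N + 1) 0) := by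
  rw [← map_measureReal_apply measurable_swap (measurableSet_failSet _ _ _), Measure.prod_swap]
  rfl

lemma swap_fibre_failSet {d N : ℕ} (V : Fin (N + 1) → Fin d → ℝ) :
    Prod.mk V ⁻¹' (Prod.swap ⁻¹' failSet d (N + 1) 0) =
      weightFail 0 fun k => ∑ s, V k s * V 0 s := by
  ext u
  exact mem_failSet_iff u V

lemma failure_probability_le {d N : ℕ} (hd : 0 < d) (hN : 0 < N) {ε : ℝ} (hε : 0 < ε)
    (hε' : ε ≤ 1 / 4) :
    (gaussianModel d (N + 1)).real (failSet d (N + 1) 0) ≤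
      4 * Real.exp (-(d * ε ^ 2 / 8)) + 2 * (N + 1) * Real.exp (-(d * ε ^ 2 / 4)) +
        2 * Real.exp (-(N * ε ^ 2 / 8)) +
          (N + 1) * Real.exp (-((1 - 2 * ε) ^ 4 * d / (4 * (1 + ε) ^ 3 * (1 + N / d)))) := by
  have hd' : (0 : ℝ) < d := by exact_mod_cast hd
  have hN' : (0 : ℝ) < N := by exact_mod_cast hN
  have hv : (Fintype.card (Fin d) : ℝ) * ((d : NNReal)⁻¹ : NNReal) = 1 := by
    simp [hd'.ne']
  have hlo : (0 : ℝ) < (1 - ε) ^ 2 * (N * ((d : NNReal)⁻¹ : NNReal)) := by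
    have : 0 < 1 - ε := by linarith
    push_cast
    positivity
  have hbad := not_goodWeights_le hN hv hε hε'
  have e1 : -ε ^ 2 / (4 * (((d : NNReal)⁻¹ : NNReal) : ℝ)) = -(d * ε ^ 2 / 4) := by
    push_cast
    field_simp
  have e2 : -(1 - 2 * ε) ^ 4 / (4 * ((1 + ε) * (((d : NNReal)⁻¹ : NNReal) : ℝ) *
      ((1 + ε) ^ 2 * (1 + N * ((d : NNReal)⁻¹ : NNReal))))) =
      -((1 - 2 * ε) ^ 4 * d / (4 * (1 + ε) ^ 3 * (1 + N / d))) := by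
    push_cast
    field_simp
  have hG := measurableSet_goodWeights (ι := Fin d) (N := N) ε
    ((1 - ε) ^ 2 * (N * ((d : NNReal)⁻¹ : NNReal)))
    ((1 + ε) ^ 2 * (1 + N * ((d : NNReal)⁻¹ : NNReal)))
  rw [e1, Fintype.card_fin] at hbad
  rw [gaussianModel_real_failSet]
  refine (prod_real_le _ _ ((measurableSet_failSet d (N + 1) 0).preimage measurable_swap)
    hG (c := 2 * Real.exp (-(d * ε ^ 2 / 8)) + (2 * Real.exp (-(d * ε ^ 2 / 4)) +
      (N + 1) * Real.exp (-((1 - 2 * ε) ^ 4 * d / (4 * (1 + ε) ^ 3 * (1 + N / d))))))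
    (by positivity) fun V hV => ?_).trans ?_
  · rw [swap_fibre_failSet]
    have := weightFail_le (ι := Fin d) hv hε hε' hlo hV
    rw [e1, e2] at this
    simpa only [Fintype.card_fin, Nat.cast_add, Nat.cast_one] using this
  · linarith

lemma le_failure_probability {d N : ℕ} (hd : 0 < d) (hN : 0 < N) {ε : ℝ} (hε : 0 < ε)
    (hε' : ε ≤ 1 / 4) {b p : ℝ} (hb : b = (1 + 2 * ε) ^ 2 / (1 - ε) ^ 2 * (d / √N) / 2)
    (hp : p = (√(2 * Real.pi))⁻¹ * Real.exp (-(b + 1) ^ 2 / 2))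
    (hexp : 2 * Real.exp (-(d * ε ^ 2 / 8)) ≤ 1)
    (hc : 0 ≤ p * (1 - (1 - p) ^ N) - 2 * Real.exp (-(d * ε ^ 2 / 4))) :
    (1 - (2 * Real.exp (-(d * ε ^ 2 / 8)) + 2 * N * Real.exp (-(d * ε ^ 2 / 4)) +
        2 * Real.exp (-(N * ε ^ 2 / 8)))) * ((1 - 2 * Real.exp (-(d * ε ^ 2 / 8))) *
          (p * (1 - (1 - p) ^ N) - 2 * Real.exp (-(d * ε ^ 2 / 4)))) ≤
      (gaussianModel d (N + 1)).real (failSet d (N + 1) 0) := by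
  have hd' : (0 : ℝ) < d := by exact_mod_cast hd
  have hN' : (0 : ℝ) < N := by exact_mod_cast hN
  have hε1 : 0 < 1 - ε := by linarith
  have hv : (Fintype.card (Fin d) : ℝ) * ((d : NNReal)⁻¹ : NNReal) = 1 := by
    simp [hd'.ne']
  have hlo : (0 : ℝ) < (1 - ε) ^ 2 * (N * ((d : NNReal)⁻¹ : NNReal)) := by
    push_cast
    positivity
  have hb0 : 0 ≤ b := by
    rw [hb]
    positivity
  have hp0 : 0 ≤ p := by
    rw [hp]
    positivity
  have e1 : -ε ^ 2 / (4 * (((d : NNReal)⁻¹ : NNReal) : ℝ)) = -(d * ε ^ 2 / 4) := by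
    push_cast
    field_simp
  have hbε : (1 + 2 * ε) ^ 2 ≤ 2 * ((1 - ε) * √(((d : NNReal)⁻¹ : NNReal) : ℝ) * b *
      √((1 - ε) ^ 2 * (N * ((d : NNReal)⁻¹ : NNReal)))) := by
    apply le_of_eq
    rw [hb]
    push_cast
    rw [Real.sqrt_mul (sq_nonneg _), Real.sqrt_sq hε1.le, Real.sqrt_mul hN'.le, Real.sqrt_inv]
    have h1 := Real.sq_sqrt hd'.le
    have h2 := Real.sqrt_pos.2 hd'
    have h3 := Real.sqrt_pos.2 hN'
    field_simp
    rw [h1]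
  have hbad := not_goodWeights_le hN hv hε hε'
  have hG := measurableSet_goodWeights (ι := Fin d) (N := N) ε
    ((1 - ε) ^ 2 * (N * ((d : NNReal)⁻¹ : NNReal)))
    ((1 + ε) ^ 2 * (1 + N * ((d : NNReal)⁻¹ : NNReal)))
  rw [probReal_compl_eq_one_sub hG, e1, Fintype.card_fin] at hbad
  rw [gaussianModel_real_failSet]
  refine le_trans ?_ (le_prod_real _ _
    ((measurableSet_failSet d (N + 1) 0).preimage measurable_swap)
    hG (c := (1 - 2 * Real.exp (-(d * ε ^ 2 / 8))) *
          (p * (1 - (1 - p) ^ N) - 2 * Real.exp (-(d * ε ^ 2 / 4)))) fun V hV => ?_)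
  · exact mul_le_mul_of_nonneg_right (by linarith) (mul_nonneg (by linarith) hc)
  · rw [swap_fibre_failSet]
    have := le_weightFail (ι := Fin d) hv hε hε' hlo hV hb0 hbε hp0 hp.le
    simp only [Fintype.card_fin, Nat.add_sub_cancel, e1] at this
    exact this hc

section Asymptotics

variable {x y : ℕ → ℝ} {ρ : ℝ}

lemma eventually_le_sq (hρ : 0 < ρ) (hx : Tendsto x atTop atTop)
    (h : Tendsto (fun m => y m ^ 2 / (x m * Real.log (x m))) atTop (𝓝 ρ)) :
    ∀ᶠ m in atTop, x m ≤ y m ^ 2 := by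
  have h1 := h.eventually_const_lt (half_lt_self hρ)
  have h2 := (Real.tendsto_log_atTop.comp hx).eventually_ge_atTop (2 / ρ)
  have h3 := hx.eventually_gt_atTop 1
  filter_upwards [h1, h2, h3] with m h1 h2 h3
  have hL : 0 < Real.log (x m) := Real.log_pos h3
  have hx0 : 0 < x m := by linarith
  rw [lt_div_iff₀ (by positivity)] at h1
  have h2' : 2 / ρ ≤ Real.log (x m) := h2
  rw [div_le_iff₀ hρ] at h2'
  nlinarith

lemma tendsto_sq_mul_exp_neg (hρ : 0 < ρ) (hx : Tendsto x atTop atTop) (hy : Tendsto y atTop atTop)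
    (h : Tendsto (fun m => y m ^ 2 / (x m * Real.log (x m))) atTop (𝓝 ρ)) {c : ℝ} (hc : 0 < c) :
    Tendsto (fun m => x m ^ 2 * Real.exp (-(c * y m))) atTop (𝓝 0) := by
  have h1 : Tendsto (fun z : ℝ => z ^ 4 * Real.exp (-(c * z))) atTop (𝓝 0) := by
    have := (Real.tendsto_pow_mul_exp_neg_atTop_nhds_zero 4).comp
      ((tendsto_id (α := ℝ)).const_mul_atTop hc)
    have h2 := this.const_mul ((c ^ 4)⁻¹)
    rw [mul_zero] at h2
    refine h2.congr fun z => ?_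
    simp only [Function.comp, id]
    field_simp
  refine squeeze_zero' (Eventually.of_forall fun m => by positivity) ?_ (h1.comp hy)
  filter_upwards [eventually_le_sq hρ hx h, hx.eventually_ge_atTop 0] with m h2 h3
  simp only [Function.comp]
  gcongr
  calc x m ^ 2 ≤ (y m ^ 2) ^ 2 := by gcongr
    _ = y m ^ 4 := by ring

lemma tendsto_mul_exp_neg (hρ : 0 < ρ) (hx : Tendsto x atTop atTop) (hy : Tendsto y atTop atTop)
    (h : Tendsto (fun m => y m ^ 2 / (x m * Real.log (x m))) atTop (𝓝 ρ)) {c : ℝ} (hc : 0 < c) :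
    Tendsto (fun m => x m * Real.exp (-(c * y m))) atTop (𝓝 0) := by
  refine squeeze_zero' ?_ ?_ (tendsto_sq_mul_exp_neg hρ hx hy h hc)
  · filter_upwards [hx.eventually_ge_atTop 0] with m h3
    positivity
  · filter_upwards [hx.eventually_ge_atTop 1] with m h3
    gcongr
    nlinarith

lemma tendsto_mul_exp_neg_sub_one (hx : Tendsto x atTop atTop) {c : ℝ} (hc : 0 < c) :
    Tendsto (fun m => x m * Real.exp (-(c * (x m - 1)))) atTop (𝓝 0) := by
  have h1 : Tendsto (fun z : ℝ => z * Real.exp (-(c * (z - 1)))) atTop (𝓝 0) := by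
    have := (Real.tendsto_pow_mul_exp_neg_atTop_nhds_zero 1).comp
      ((tendsto_id (α := ℝ)).const_mul_atTop hc)
    have h2 := this.const_mul (c⁻¹ * Real.exp c)
    rw [mul_zero] at h2
    refine h2.congr fun z => ?_
    simp only [Function.comp, id, pow_one]
    rw [show -(c * (z - 1)) = c + -(c * z) by ring, Real.exp_add]
    field_simp
  exact h1.comp hx

lemma tendsto_log_div (hρ : 0 < ρ) (hx : Tendsto x atTop atTop) (hy : Tendsto y atTop atTop)
    (h : Tendsto (fun m => y m ^ 2 / (x m * Real.log (x m))) atTop (𝓝 ρ)) :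
    Tendsto (fun m => Real.log (x m) / y m) atTop (𝓝 0) := by
  have h1 : Tendsto (fun z : ℝ => 2 * (Real.log z / z)) atTop (𝓝 0) := by
    have := (Real.isLittleO_log_id_atTop.tendsto_div_nhds_zero).const_mul 2
    simpa using this
  refine squeeze_zero' ?_ ?_ (h1.comp hy)
  · filter_upwards [hx.eventually_ge_atTop 1, hy.eventually_ge_atTop 0] with m h3 h4
    exact div_nonneg (Real.log_nonneg h3) h4
  · filter_upwards [eventually_le_sq hρ hx h, hx.eventually_gt_atTop 0, hy.eventually_gt_atTop 0]
      with m h2 h3 h4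
    simp only [Function.comp]
    rw [← mul_div_assoc]
    gcongr
    calc Real.log (x m) ≤ Real.log (y m ^ 2) := Real.log_le_log h3 h2
      _ = 2 * Real.log (y m) := by rw [Real.log_pow]; norm_num

lemma tendsto_sub_one_mul_log_div (hρ : 0 < ρ) (hx : Tendsto x atTop atTop)
    (h : Tendsto (fun m => y m ^ 2 / (x m * Real.log (x m))) atTop (𝓝 ρ)) :
    Tendsto (fun m => (x m - 1) * Real.log (x m) / y m ^ 2) atTop (𝓝 ρ⁻¹) := by
  have h1 := (tendsto_const_nhds (x := (1 : ℝ))).sub (tendsto_inv_atTop_zero.comp hx)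
  have h2 := h1.mul (h.inv₀ hρ.ne')
  rw [sub_zero, one_mul] at h2
  refine h2.congr' ?_
  filter_upwards [hx.eventually_gt_atTop 0] with m h3
  simp only [Function.comp]
  rw [inv_div]
  field_simp

lemma tendsto_sq_mul_exp_neg_div (hρ : 0 < ρ) (hx : Tendsto x atTop atTop)
    (hy : Tendsto y atTop atTop)
    (h : Tendsto (fun m => y m ^ 2 / (x m * Real.log (x m))) atTop (𝓝 ρ)) {q : ℝ}
    (hq : 2 < q * ρ) :
    Tendsto (fun m => x m ^ 2 * Real.exp (-(q * (y m / (1 + (x m - 1) / y m))))) atTop (𝓝 0) := by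
  obtain ⟨κ, hκ, hκq⟩ := exists_between hq
  have h1 : Tendsto (fun m => q * (Real.log (x m) / y m +
      (x m - 1) * Real.log (x m) / y m ^ 2)⁻¹) atTop (𝓝 (q * ρ)) := by
    have := ((tendsto_log_div hρ hx hy h).add (tendsto_sub_one_mul_log_div hρ hx h)).inv₀
      (by rw [zero_add]; positivity)
    rw [zero_add, inv_inv] at this
    exact this.const_mul q
  have h2 : Tendsto (fun z : ℝ => z ^ (-(κ - 2))) atTop (𝓝 0) :=
    tendsto_rpow_neg_atTop (by linarith)
  refine squeeze_zero' (Eventually.of_forall fun m => by positivity) ?_ (h2.comp hx)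
  filter_upwards [h1.eventually_const_lt hκq, hx.eventually_gt_atTop 1, hy.eventually_gt_atTop 0]
    with m h3 h4 h5
  have hL : 0 < Real.log (x m) := Real.log_pos h4
  have hx0 : 0 < x m := by linarith
  have hx1 : 0 < x m - 1 := by linarith
  have h6 : κ * Real.log (x m) ≤ q * (y m / (1 + (x m - 1) / y m)) := by
    have : q * (y m / (1 + (x m - 1) / y m)) = q * (Real.log (x m) / y m +
      (x m - 1) * Real.log (x m) / y m ^ 2)⁻¹ * Real.log (x m) := by
      field_simp
    rw [this]
    gcongr
  simp only [Function.comp]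
  rw [Real.rpow_def_of_pos hx0]
  have h7 : x m ^ 2 = Real.exp (2 * Real.log (x m)) := by
    rw [show (2 : ℝ) * Real.log (x m) = Real.log (x m ^ 2) by rw [Real.log_pow]; norm_num,
      Real.exp_log (by positivity)]
  rw [h7, ← Real.exp_add]
  gcongr
  linarith

lemma eventually_sq_half_le_log (hρ : 0 < ρ) (hx : Tendsto x atTop atTop)
    (h : Tendsto (fun m => y m ^ 2 / (x m * Real.log (x m))) atTop (𝓝 ρ))
    (hy : Tendsto y atTop atTop) {c κ : ℝ} (hκ : c ^ 2 * ρ / 8 < κ) :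
    ∀ᶠ m in atTop, (c * (y m / √(x m - 1)) / 2 + 1) ^ 2 / 2 ≤ κ * Real.log (x m) := by
  have h1 := (((tendsto_sub_one_mul_log_div hρ hx h).inv₀ (by positivity)).sqrt)
  rw [inv_inv] at h1
  have hL := Real.tendsto_log_atTop.comp hx
  have h2 := (Real.tendsto_sqrt_atTop.comp hL).inv_tendsto_atTop
  have h3 := ((((h1.const_mul c).div_const 2).add h2).pow 2).div_const 2
  have h4 : (c * √ρ / 2 + 0) ^ 2 / 2 = c ^ 2 * ρ / 8 := by
    rw [add_zero, div_pow, mul_pow, Real.sq_sqrt hρ.le]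
    ring
  rw [h4] at h3
  filter_upwards [h3.eventually_lt_const hκ, hx.eventually_gt_atTop 1, hy.eventually_gt_atTop 0]
    with m h5 h6 h7
  have hL : 0 < Real.log (x m) := Real.log_pos h6
  have hx1 : 0 < x m - 1 := by linarith
  refine le_trans (le_of_eq ?_) (mul_le_mul_of_nonneg_right h5.le hL.le)
  simp only [Function.comp, Pi.inv_apply]
  rw [inv_div, Real.sqrt_div (sq_nonneg _), Real.sqrt_sq h7.le, Real.sqrt_mul hx1.le]
  have hs := Real.sqrt_pos.2 hL
  have hs' := Real.sq_sqrt hL.le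
  have hs1 := Real.sqrt_pos.2 hx1
  rw [div_mul_eq_mul_div]
  congr 1
  nth_rewrite 3 [← hs']
  rw [← mul_pow]
  congr 1
  field_simp

end Asymptotics

lemma tendsto_mul_failure_probability_zero {ρ : ℝ} (hρ : 8 < ρ) {n d : ℕ → ℕ}
    (hn : Tendsto n atTop atTop) (hd : Tendsto d atTop atTop)
    (hρlim : Tendsto (fun m => (d m : ℝ) ^ 2 / (n m * Real.log (n m))) atTop (𝓝 ρ)) :
    Tendsto (fun m => (n m : ℝ) * (gaussianModel (d m) (n m)).real (failSet (d m) (n m) 0))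
      atTop (𝓝 0) := by
  have hρ0 : 0 < ρ := by linarith
  have hx : Tendsto (fun m => (n m : ℝ)) atTop atTop := tendsto_natCast_atTop_atTop.comp hn
  have hy : Tendsto (fun m => (d m : ℝ)) atTop atTop := tendsto_natCast_atTop_atTop.comp hd
  obtain ⟨ε, hεq, hε, hε'⟩ : ∃ ε : ℝ, 2 < (1 - 2 * ε) ^ 4 / (4 * (1 + ε) ^ 3) * ρ ∧
      0 < ε ∧ ε ≤ 1 / 4 := by
    have hcont : ContinuousAt (fun ε : ℝ => (1 - 2 * ε) ^ 4 / (4 * (1 + ε) ^ 3) * ρ) 0 := by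
      refine ContinuousAt.mul (ContinuousAt.div (by fun_prop) (by fun_prop) (by norm_num))
        continuousAt_const
    have h1 : ∀ᶠ ε in 𝓝[>] (0 : ℝ), 2 < (1 - 2 * ε) ^ 4 / (4 * (1 + ε) ^ 3) * ρ :=
      (hcont.tendsto.mono_left nhdsWithin_le_nhds).eventually_const_lt (by norm_num; linarith)
    have h2 : ∀ᶠ ε in 𝓝[>] (0 : ℝ), ε ∈ Set.Ioc (0 : ℝ) (1 / 4) := Ioc_mem_nhdsGT (by norm_num)
    exact (h1.and h2).exists
  have hε2 : 0 < ε ^ 2 := by positivity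
  have t1 := (tendsto_mul_exp_neg hρ0 hx hy hρlim (c := ε ^ 2 / 8) (by positivity)).const_mul 4
  have t2 := (tendsto_sq_mul_exp_neg hρ0 hx hy hρlim (c := ε ^ 2 / 4) (by positivity)).const_mul 2
  have t3 := (tendsto_mul_exp_neg_sub_one hx (c := ε ^ 2 / 8) (by positivity)).const_mul 2
  have t4 := tendsto_sq_mul_exp_neg_div hρ0 hx hy hρlim hεq
  have t := ((t1.add t2).add t3).add t4
  simp only [mul_zero, add_zero] at t
  refine squeeze_zero' (Eventually.of_forall fun m => by positivity) ?_ t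
  filter_upwards [hn.eventually_ge_atTop 2, hd.eventually_ge_atTop 1] with m h1 h2
  obtain ⟨N, hN⟩ : ∃ N, n m = N + 1 := ⟨n m - 1, by omega⟩
  have := failure_probability_le (d := d m) (N := N) (by omega) (by omega) hε hε'
  rw [hN]
  refine (mul_le_mul_of_nonneg_left this (by positivity)).trans (le_of_eq ?_)
  push_cast
  rw [add_sub_cancel_right, show ε ^ 2 / 8 * (d m : ℝ) = d m * ε ^ 2 / 8 by ring,
    show ε ^ 2 / 4 * (d m : ℝ) = d m * ε ^ 2 / 4 by ring,
    show ε ^ 2 / 8 * (N : ℝ) = N * ε ^ 2 / 8 by ring, div_mul_div_comm]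
  ring

lemma one_half_le_one_sub_pow {p : ℝ} (hp : p ≤ 1) {N : ℕ} (hN : 1 ≤ N * p) :
    1 / 2 ≤ 1 - (1 - p) ^ N := by
  have h1 : (1 - p) ^ N ≤ Real.exp (-p) ^ N :=
    pow_le_pow_left₀ (by linarith) (Real.one_sub_le_exp_neg p) N
  rw [← Real.exp_nat_mul] at h1
  have h2 : Real.exp (N * -p) ≤ Real.exp (-1) := Real.exp_le_exp.2 (by linarith)
  have h3 : Real.exp (-1) ≤ 1 / 2 := by
    rw [Real.exp_neg, inv_le_comm₀ (Real.exp_pos _) (by norm_num)]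
    have := Real.add_one_le_exp (1 : ℝ)
    norm_num at this ⊢
    linarith
  linarith

lemma tendsto_mul_failure_probability_atTop {ρ : ℝ} (hρ0 : 0 < ρ) (hρ : ρ < 8) {n d : ℕ → ℕ}
    (hn : Tendsto n atTop atTop) (hd : Tendsto d atTop atTop)
    (hρlim : Tendsto (fun m => (d m : ℝ) ^ 2 / (n m * Real.log (n m))) atTop (𝓝 ρ)) :
    Tendsto (fun m => (n m : ℝ) * (gaussianModel (d m) (n m)).real (failSet (d m) (n m) 0))
      atTop atTop := by
  have hx : Tendsto (fun m => (n m : ℝ)) atTop atTop := tendsto_natCast_atTop_atTop.comp hn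
  have hy : Tendsto (fun m => (d m : ℝ)) atTop atTop := tendsto_natCast_atTop_atTop.comp hd
  obtain ⟨ε, hεq, hε, hε'⟩ : ∃ ε : ℝ, ((1 + 2 * ε) ^ 2 / (1 - ε) ^ 2) ^ 2 * ρ / 8 < 1 ∧
      0 < ε ∧ ε ≤ 1 / 4 := by
    have hcont : ContinuousAt
        (fun ε : ℝ => ((1 + 2 * ε) ^ 2 / (1 - ε) ^ 2) ^ 2 * ρ / 8) 0 := by
      refine ContinuousAt.div_const (ContinuousAt.mul (ContinuousAt.pow (ContinuousAt.div
        (by fun_prop) (by fun_prop) (by norm_num)) 2) continuousAt_const) 8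
    have h1 : ∀ᶠ ε in 𝓝[>] (0 : ℝ), ((1 + 2 * ε) ^ 2 / (1 - ε) ^ 2) ^ 2 * ρ / 8 < 1 :=
      (hcont.tendsto.mono_left nhdsWithin_le_nhds).eventually_lt_const (by norm_num; linarith)
    have h2 : ∀ᶠ ε in 𝓝[>] (0 : ℝ), ε ∈ Set.Ioc (0 : ℝ) (1 / 4) := Ioc_mem_nhdsGT (by norm_num)
    exact (h1.and h2).exists
  obtain ⟨κ, hκ, hκ1⟩ := exists_between hεq
  have hε2 : 0 < ε ^ 2 := by positivity
  set C : ℝ := (√(2 * Real.pi))⁻¹ with hC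
  have hC0 : 0 < C := by positivity
  have hC1 : C ≤ 1 := by
    refine inv_le_one_of_one_le₀ (Real.one_le_sqrt.2 ?_)
    linarith [Real.pi_gt_three]
  have t1 := tendsto_mul_exp_neg hρ0 hx hy hρlim (c := ε ^ 2 / 8) (by positivity)
  have t2 := tendsto_mul_exp_neg hρ0 hx hy hρlim (c := ε ^ 2 / 4) (by positivity)
  have t3 := tendsto_mul_exp_neg_sub_one hx (c := ε ^ 2 / 8) (by positivity)
  have tp : Tendsto (fun m => C / 16 * (n m : ℝ) ^ (1 - κ)) atTop atTop :=
    ((tendsto_rpow_atTop (by linarith : 0 < 1 - κ)).comp hx).const_mul_atTop (by positivity)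
  refine tendsto_atTop_mono' _ ?_ tp
  filter_upwards [hn.eventually_ge_atTop 2, hd.eventually_ge_atTop 1,
    t1.eventually_le_const (by norm_num : (0 : ℝ) < 1 / 16),
    t2.eventually_le_const (by norm_num : (0 : ℝ) < 1 / 16),
    t3.eventually_le_const (by norm_num : (0 : ℝ) < 1 / 16),
    tp.eventually_ge_atTop 1, eventually_sq_half_le_log hρ0 hx hρlim hy hκ]
    with m h1 h2 h3 h4 h5 h6 h7
  obtain ⟨N, hN⟩ : ∃ N, n m = N + 1 := ⟨n m - 1, by omega⟩
  have hN0 : 0 < N := by omega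
  rw [hN] at h3 h4 h5 h6 h7 ⊢
  push_cast at h3 h4 h5 h6 h7 ⊢
  rw [add_sub_cancel_right] at h5 h7
  rw [show ε ^ 2 / 8 * (d m : ℝ) = d m * ε ^ 2 / 8 by ring] at h3
  rw [show ε ^ 2 / 4 * (d m : ℝ) = d m * ε ^ 2 / 4 by ring] at h4
  rw [show ε ^ 2 / 8 * (N : ℝ) = N * ε ^ 2 / 8 by ring] at h5
  set b := (1 + 2 * ε) ^ 2 / (1 - ε) ^ 2 * (d m / √N) / 2 with hb
  set p := C * Real.exp (-(b + 1) ^ 2 / 2) with hp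
  have hN' : (1 : ℝ) ≤ N := by exact_mod_cast hN0
  have hp0 : 0 < p := by positivity
  have hp1 : p ≤ 1 := by
    refine mul_le_one₀ hC1 (Real.exp_pos _).le (Real.exp_le_one_iff.2 ?_)
    rw [neg_div]
    exact neg_nonpos.2 (by positivity)
  have hnp : C * ((N : ℝ) + 1) ^ (1 - κ) ≤ (N + 1) * p := by
    rw [Real.rpow_def_of_pos (by positivity), hp]
    have : ((N : ℝ) + 1) * (C * Real.exp (-(b + 1) ^ 2 / 2)) =
        C * Real.exp (Real.log (N + 1) + -(b + 1) ^ 2 / 2) := by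
      rw [Real.exp_add, Real.exp_log (by positivity)]
      ring
    rw [this]
    gcongr
    linarith
  have hNp : 1 ≤ N * p := by linarith
  have hpow := one_half_le_one_sub_pow hp1 hNp
  set E₁ := Real.exp (-(d m * ε ^ 2 / 8))
  set E₂ := Real.exp (-(d m * ε ^ 2 / 4))
  set E₃ := Real.exp (-(N * ε ^ 2 / 8))
  have hE₁ : 0 < E₁ := Real.exp_pos _
  have hE₂ : 0 < E₂ := Real.exp_pos _
  have hE₃ : 0 < E₃ := Real.exp_pos _
  have hE₁' : E₁ ≤ 1 / 16 := (le_mul_of_one_le_left hE₁.le (by linarith)).trans h3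
  have hE₃' : E₃ ≤ 1 / 16 := (le_mul_of_one_le_left hE₃.le (by linarith)).trans h5
  have hpp : p * (1 / 2) ≤ p * (1 - (1 - p) ^ N) := mul_le_mul_of_nonneg_left hpow hp0.le
  have hbr : p / 4 ≤ p * (1 - (1 - p) ^ N) - 2 * E₂ := by
    have : (N + 1) * (2 * E₂) ≤ (N + 1) * (p / 4) := by linarith
    have := le_of_mul_le_mul_left this (by positivity)
    linarith
  have key := le_failure_probability (d := d m) (by omega) hN0 hε hε' hb hp (by linarith)
    (by linarith)
  have hlow : 1 / 2 * (1 / 2 * (p / 4)) ≤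
      (gaussianModel (d m) (N + 1)).real (failSet (d m) (N + 1) 0) := by
    have g1 : 1 / 2 ≤ 1 - (2 * E₁ + 2 * N * E₂ + 2 * E₃) := by linarith
    have g2 : 1 / 2 ≤ 1 - 2 * E₁ := by linarith
    have g3 : (0 : ℝ) ≤ 1 / 2 * (p / 4) := by positivity
    exact (mul_le_mul g1 (mul_le_mul g2 hbr (by positivity) (by linarith)) g3
      (by linarith)).trans key
  have := mul_le_mul_of_nonneg_left hlow (by positivity : 0 ≤ (N : ℝ) + 1)
  linarith

/-- **Single-coordinate failure probability.** If `n, d → ∞` with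
`d²/(n log n) → ρ ∈ (0,∞)`, then `n P(F_1) → 0` when `ρ > 8` and `n P(F_1) → ∞`
when `ρ < 8`. -/
theorem n_times_failure_probability (ρ : ℝ) (hρ : 0 < ρ) (n d : ℕ → ℕ)
    (hn : Tendsto n atTop atTop) (hd : Tendsto d atTop atTop)
    (hρlim : Tendsto (fun m => (d m : ℝ) ^ 2 / (n m * Real.log (n m))) atTop (𝓝 ρ)) :
    (8 < ρ →
      Tendsto (fun m => (n m : ℝ) *
          (gaussianModel (d m) (n m) (failSet (d m) (n m) 0)).toReal) atTop (𝓝 0)) ∧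
    (ρ < 8 →
      Tendsto (fun m => (n m : ℝ) *
          (gaussianModel (d m) (n m) (failSet (d m) (n m) 0)).toReal) atTop atTop) := by
  exact ⟨fun h => tendsto_mul_failure_probability_zero h hn hd hρlim,
    fun h => tendsto_mul_failure_probability_atTop hρ h hn hd hρlim⟩

end
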